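/- Let f : (0, ∞) → ℝ. The entrywise map f[−] preserves positive semidefiniteness on P_n((0, ∞)) for all n ≥ 1 if and only if there exist coefficients c_k ≥ 0 for all k ≥ 0 such that f(x) = Σ_{k=0}^∞ c_k x^k for all x ∈ (0, ∞), with the series converging on (0, ∞). -/

import Mathlib

open Finset Filter Topology

/-- Signed sum over pairs of subsets gives an iterated forward difference. -/
theorem signed_sum_eq_fwdDiff {ι : Type*} [DecidableEq ι] (f : ℝ → ℝ) (h : ℝ) (s : Finset ι) :
    ∀ a : ℝ, ∑ S ∈ s.powerset, ∑ T ∈ s.powerset,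
      (-1 : ℝ) ^ S.card * (-1 : ℝ) ^ T.card * f (a + ((S ∩ T).card : ℝ) * h)
      = (fwdDiff h)^[s.card] f a := by
  induction s using Finset.induction_on with
  | empty => intro a; simp
  | insert i s hi ih =>
    intro a
    rw [Finset.card_insert_of_notMem hi, Function.iterate_succ', Function.comp_apply, fwdDiff,
      ← ih, ← ih]
    have key : ∀ S ∈ s.powerset, i ∉ S := fun S hS hiS => hi (Finset.mem_powerset.1 hS hiS)
    rw [Finset.sum_powerset_insert hi]
    simp_rw [Finset.sum_powerset_insert hi]
    rw [← Finset.sum_add_distrib, ← Finset.sum_sub_distrib]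
    refine Finset.sum_congr rfl fun S hS => ?_
    rw [← Finset.sum_add_distrib, ← Finset.sum_add_distrib, ← Finset.sum_add_distrib,
      ← Finset.sum_sub_distrib]
    refine Finset.sum_congr rfl fun T hT => ?_
    have hS' := key S hS
    have hT' := key T hT
    rw [Finset.inter_insert_of_notMem hS', Finset.insert_inter_of_notMem hT',
      ← Finset.insert_inter_distrib, Finset.card_insert_of_notMem hS',
      Finset.card_insert_of_notMem hT',
      Finset.card_insert_of_notMem (fun hh => hS' (Finset.mem_inter.1 hh).1)]
    push_cast
    rw [show a + (((S ∩ T).card : ℝ) + 1) * h = a + h + ((S ∩ T).card : ℝ) * h by ring]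
    ring

theorem inter_posSemidef (N : ℕ) (a h : ℝ) (ha : 0 ≤ a) (hh : 0 ≤ h) :
    (Matrix.of fun S T : Finset (Fin N) => a + ((S ∩ T).card : ℝ) * h).PosSemidef := by
  have h1 : (Matrix.of fun S T : Finset (Fin N) => a + ((S ∩ T).card : ℝ) * h) =
      a • Matrix.vecMulVec (fun _ : Finset (Fin N) => (1 : ℝ)) (star fun _ => (1 : ℝ)) +
      h • ∑ i : Fin N, Matrix.vecMulVec (fun S : Finset (Fin N) => if i ∈ S then (1 : ℝ) else 0)
        (star fun S : Finset (Fin N) => if i ∈ S then (1 : ℝ) else 0) := by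
    ext S T
    have : ((S ∩ T).card : ℝ) = ∑ i : Fin N, (if i ∈ S then (1 : ℝ) else 0) *
        (if i ∈ T then (1 : ℝ) else 0) := by
      rw [Finset.card_eq_sum_ones]
      push_cast
      rw [← Finset.sum_filter_add_sum_filter_not univ (fun i => i ∈ S ∩ T)]
      have e1 : (univ.filter fun i => i ∈ S ∩ T) = S ∩ T := by ext; simp
      rw [e1]
      have e2 : ∑ x with x ∉ S ∩ T, ((if x ∈ S then (1 : ℝ) else 0) * if x ∈ T then 1 else 0)
          = 0 := by
        refine Finset.sum_eq_zero fun x hx => ?_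
        simp only [Finset.mem_filter, Finset.mem_inter] at hx
        by_cases h1 : x ∈ S <;> by_cases h2 : x ∈ T <;> simp_all
      rw [e2, add_zero]
      refine Finset.sum_congr rfl fun x hx => ?_
      rw [Finset.mem_inter] at hx
      simp [hx.1, hx.2]
    simp only [Matrix.of_apply, Matrix.add_apply, Matrix.smul_apply, Matrix.sum_apply,
      Matrix.vecMulVec_apply, star_trivial, smul_eq_mul, this]
    ring
  rw [h1]
  refine Matrix.PosSemidef.add ((Matrix.posSemidef_vecMulVec_self_star _).smul ha)
    (Matrix.PosSemidef.smul (Matrix.posSemidef_sum _ fun i _ =>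
      Matrix.posSemidef_vecMulVec_self_star _) hh)

theorem fwdDiff_nonneg (f : ℝ → ℝ)
    (hf : ∀ n : ℕ, 1 ≤ n → ∀ A : Matrix (Fin n) (Fin n) ℝ, A.PosSemidef →
        (∀ j k, 0 < A j k) → (A.map f).PosSemidef) (N : ℕ) (a h : ℝ) (ha : 0 < a) (hh : 0 ≤ h) :
    0 ≤ (fwdDiff h)^[N] f a := by
  have hA := inter_posSemidef N a h ha.le hh
  set A := (Matrix.of fun S T : Finset (Fin N) => a + ((S ∩ T).card : ℝ) * h) with hAdef
  have e := Fintype.equivFin (Finset (Fin N))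
  have h2 := hf (Fintype.card (Finset (Fin N))) Fintype.card_pos (A.submatrix e.symm e.symm)
    (hA.submatrix _) (fun j k => by
      simp only [hAdef, Matrix.submatrix_apply, Matrix.of_apply]; positivity)
  have h3 := h2.submatrix e
  have h4 : ((A.submatrix e.symm e.symm).map f).submatrix e e = A.map f := by
    ext; simp
  rw [h4] at h3
  have h5 := h3.dotProduct_mulVec_nonneg (fun S => (-1 : ℝ) ^ S.card)
  have h6 := signed_sum_eq_fwdDiff f h (Finset.univ : Finset (Fin N)) a
  rw [Finset.card_univ, Fintype.card_fin, Finset.powerset_univ] at h6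
  rw [← h6]
  refine h5.trans_eq ?_
  simp only [dotProduct, Matrix.mulVec, Finset.mul_sum, Pi.star_apply, star_trivial,
    Matrix.map_apply, hAdef, Matrix.of_apply]
  refine Finset.sum_congr rfl fun S _ => Finset.sum_congr rfl fun T _ => ?_
  ring

/-- Bernstein polynomials in terms of forward differences. -/
theorem bern_id (G : ℝ → ℝ) (h y t : ℝ) (n : ℕ) :
    ∑ k ∈ range (n + 1), (n.choose k : ℝ) * t ^ k * (1 - t) ^ (n - k) * G (y + k * h)
      = ∑ k ∈ range (n + 1), (n.choose k : ℝ) * t ^ k * (fwdDiff h)^[k] G y := by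
  let D : Module.End ℝ (ℝ → ℝ) :=
    { toFun := fwdDiff h
      map_add' := fwdDiff_add h
      map_smul' := fun r g => fwdDiff_const_smul h r g }
  have hD : ∀ k : ℕ, ∀ g : ℝ → ℝ, (D ^ k) g = (fwdDiff h)^[k] g := by
    intro k g
    rw [Module.End.pow_apply]
    rfl
  have hE : ∀ k : ℕ, ∀ (g : ℝ → ℝ) (y : ℝ), ((D + 1) ^ k) g y = g (y + k * h) := by
    intro k
    induction k with
    | zero => intro g y; simp
    | succ k ih =>
      intro g y
      rw [pow_succ, Module.End.mul_apply, ih]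
      change g (y + k * h + h) - g (y + k * h) + g (y + k * h) = _
      push_cast
      rw [sub_add_cancel]
      congr 1
      ring
  have hL : t • (D + 1) + (1 - t) • (1 : Module.End ℝ (ℝ → ℝ)) = t • D + 1 := by
    module
  have c1 : Commute (t • (D + 1)) ((1 - t) • (1 : Module.End ℝ (ℝ → ℝ))) :=
    (Commute.one_right _).smul_right _
  have h1 := c1.add_pow n
  rw [hL, (Commute.one_right (t • D)).add_pow n] at h1
  have h2 := congrFun (LinearMap.congr_fun h1 G) y
  simp only [smul_pow, one_pow, mul_one, LinearMap.sum_apply, Finset.sum_apply, mul_smul_comm,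
    ← nsmul_eq_mul', LinearMap.smul_apply, Pi.smul_apply, hD, hE, smul_eq_mul] at h2
  simp only [nsmul_eq_mul] at h2
  refine Eq.trans ?_ (h2.symm.trans ?_)
  · refine Finset.sum_congr rfl fun k _ => ?_
    ring
  · refine Finset.sum_congr rfl fun k _ => ?_
    ring

theorem am_nonneg (f : ℝ → ℝ)
    (H : ∀ (N : ℕ) (a h : ℝ), 0 < a → 0 ≤ h → 0 ≤ (fwdDiff h)^[N] f a)
    {x : ℝ} (hx : 0 < x) : 0 ≤ f x := by simpa using H 0 x 0 hx le_rfl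

theorem am_mono (f : ℝ → ℝ)
    (H : ∀ (N : ℕ) (a h : ℝ), 0 < a → 0 ≤ h → 0 ≤ (fwdDiff h)^[N] f a)
    {x y : ℝ} (hx : 0 < x) (hxy : x ≤ y) : f x ≤ f y := by
  have := H 1 x (y - x) hx (by linarith)
  simp [fwdDiff] at this
  linarith

theorem am_step (f : ℝ → ℝ)
    (H : ∀ (N : ℕ) (a h : ℝ), 0 < a → 0 ≤ h → 0 ≤ (fwdDiff h)^[N] f a)
    {x h : ℝ} (hx : 0 < x) (hh : 0 ≤ h) (n : ℕ) :
    n * (f (x + h) - f x) ≤ f (x + n * h) := by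
  have h1 := shift_eq_sum_fwdDiff_iter h f n x
  rcases n with _ | n
  · simpa using am_nonneg f H hx
  rw [nsmul_eq_mul] at h1
  rw [h1]
  have h2 := Finset.single_le_sum (s := range (n + 1 + 1)) (a := 1)
    (f := fun k => (n + 1).choose k • (fwdDiff h)^[k] f x)
    (fun i _ => nsmul_nonneg (H i x h hx hh) _) (by simp)
  refine le_trans (le_of_eq ?_) h2
  simp [fwdDiff]

theorem am_cont (f : ℝ → ℝ)
    (H : ∀ (N : ℕ) (a h : ℝ), 0 < a → 0 ≤ h → 0 ≤ (fwdDiff h)^[N] f a)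
    {x : ℝ} (hx : 0 < x) : ContinuousAt f x := by
  rw [Metric.continuousAt_iff]
  intro ε hε
  obtain ⟨n, hn⟩ := exists_nat_gt (f (x + 2) / ε)
  have hn' : f (x + 2) < n * ε := by rwa [div_lt_iff₀ hε] at hn
  have h0 : 0 ≤ f (x + 2) := am_nonneg f H (by linarith)
  have hnpos : (0 : ℝ) < n := by
    by_contra hc
    have : (n : ℝ) = 0 := le_antisymm (not_lt.1 hc) (Nat.cast_nonneg n)
    rw [this] at hn'; linarith
  have key : ∀ u v : ℝ, 0 < u → u ≤ v → v ≤ x + 1 → v - u ≤ 1 / n → f v - f u < ε := by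
    intro u v hu huv hv hd
    have h1 := am_step f H hu (sub_nonneg.2 huv) n
    rw [add_sub_cancel] at h1
    have h2 : (n : ℝ) * (v - u) ≤ 1 := by
      rw [le_div_iff₀ hnpos] at hd; linarith
    have h3 : f (u + n * (v - u)) ≤ f (x + 2) :=
      am_mono f H (by nlinarith [mul_nonneg hnpos.le (sub_nonneg.2 huv)]) (by linarith)
    have h4 : n * (f v - f u) < n * ε := by linarith
    exact lt_of_mul_lt_mul_left h4 hnpos.le
  refine ⟨min (min x 1) (1 / n), by positivity, fun y hy => ?_⟩
  rw [Real.dist_eq, lt_min_iff, lt_min_iff, abs_lt, abs_lt, abs_lt] at hy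
  rw [Real.dist_eq]
  obtain ⟨⟨⟨h1, h2⟩, h3, h4⟩, h5, h6⟩ := hy
  rcases le_total x y with hxy | hxy
  · have := am_mono f H hx hxy
    rw [abs_of_nonneg (by linarith)]
    exact key x y hx hxy (by linarith) (by linarith)
  · have := am_mono f H (by linarith : 0 < y) hxy
    rw [abs_of_nonpos (by linarith), neg_sub]
    exact key y x (by linarith) hxy (by linarith) (by linarith)

theorem am_approx (f : ℝ → ℝ)
    (H : ∀ (N : ℕ) (a h : ℝ), 0 < a → 0 ≤ h → 0 ≤ (fwdDiff h)^[N] f a)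
    (N : ℕ) : ∃ p : ℕ → ℝ, (∀ k, 0 ≤ p k) ∧ ∀ x : ℝ, 0 ≤ x → x ≤ N + 1 →
    Summable (fun k => p k * x ^ k) ∧
    |∑' k, p k * x ^ k - f (x + 1 / (N + 1))| ≤ 1 / (N + 1) := by
  have hN : (0 : ℝ) < (N : ℝ) + 1 := by positivity
  let g : C(unitInterval, ℝ) := ⟨fun t => f ((N + 1) * t + 1 / (N + 1)), by
    rw [continuous_iff_continuousAt]
    intro t
    have ht : (0 : ℝ) ≤ t := t.2.1
    have hpos : (0 : ℝ) < (N + 1) * t + 1 / (N + 1) := by positivity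
    exact ContinuousAt.comp (f := fun t : unitInterval => ((N : ℝ) + 1) * t + 1 / (N + 1))
      (am_cont f H hpos) (by fun_prop)⟩
  have h1 := bernsteinApproximation_uniform g
  rw [Metric.tendsto_atTop] at h1
  obtain ⟨m, hm⟩ := h1 (1 / (N + 1)) (by positivity)
  have hm := hm (m + 1) (by omega)
  set n := m + 1 with hn
  have hnpos : (0 : ℝ) < n := by rw [hn]; positivity
  set h : ℝ := (N + 1) / n with hh
  set y : ℝ := 1 / (N + 1) with hy
  have hypos : 0 < y := by positivity
  refine ⟨fun k => (n.choose k : ℝ) * (fwdDiff h)^[k] f y / (N + 1) ^ k, fun k => ?_,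
    fun x hx0 hx1 => ?_⟩
  · have := H k y h hypos (by positivity)
    positivity
  have hz : ∀ k ∉ range (n + 1),
      (n.choose k : ℝ) * (fwdDiff h)^[k] f y / (N + 1) ^ k * x ^ k = 0 := by
    intro k hk
    rw [Nat.choose_eq_zero_of_lt (by simpa using hk)]
    simp
  refine ⟨summable_of_ne_finset_zero hz, ?_⟩
  rw [tsum_eq_sum hz]
  let t : unitInterval := ⟨x / (N + 1), by positivity, by rw [div_le_one hN]; exact hx1⟩
  have h2 := ((ContinuousMap.dist_le_iff_of_nonempty).1 hm.le) t
  rw [Real.dist_eq, bernsteinApproximation.apply] at h2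
  have h3 : g t = f (x + y) := by
    change f ((N + 1) * (x / (N + 1)) + y) = _
    rw [mul_div_cancel₀ _ hN.ne']
  rw [h3] at h2
  convert h2 using 3
  have h4 := bern_id f h y (x / (N + 1)) n
  rw [Finset.sum_range (fun k => (n.choose k : ℝ) * (x / (N + 1)) ^ k *
    (1 - x / (N + 1)) ^ (n - k) * f (y + k * h))] at h4
  refine Eq.trans ?_ (h4.symm.trans ?_)
  · refine Finset.sum_congr rfl fun k _ => ?_
    rw [div_pow]; ring
  · refine Finset.sum_congr rfl fun k _ => ?_
    rw [bernstein_apply, smul_eq_mul]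
    congr 1
    change _ = f ((N + 1) * ((k : ℝ) / n) + y)
    congr 1
    rw [hh]; ring

theorem am_series (f : ℝ → ℝ)
    (H : ∀ (N : ℕ) (a h : ℝ), 0 < a → 0 ≤ h → 0 ≤ (fwdDiff h)^[N] f a)
    : ∃ c : ℕ → ℝ, (∀ k, 0 ≤ c k) ∧
      ∀ x : ℝ, 0 < x → HasSum (fun k => c k * x ^ k) (f x) := by
  choose p hp0 hp using am_approx f H
  -- bounds
  have hb : ∀ x : ℝ, 0 < x → ∀ N : ℕ, x ≤ N + 1 → ∀ k, p N k * x ^ k ≤ f (x + 1) + 1 := by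
    intro x hx N hN k
    obtain ⟨hs, ha⟩ := hp N x hx.le hN
    have h1 : p N k * x ^ k ≤ ∑' k, p N k * x ^ k :=
      hs.le_tsum k (fun j _ => mul_nonneg (hp0 N j) (by positivity))
    have h2 : (1 : ℝ) / (N + 1) ≤ 1 := by
      rw [div_le_one (by positivity)]; linarith [(Nat.cast_nonneg N : (0 : ℝ) ≤ N)]
    have h3 : (0 : ℝ) < 1 / (N + 1) := by positivity
    have h4 : f (x + 1 / (N + 1)) ≤ f (x + 1) := am_mono f H (by linarith) (by linarith)
    linarith [(abs_le.1 ha).2]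
  let U : Ultrafilter ℕ := hyperfilter ℕ
  have hU : (U : Filter ℕ) ≤ atTop := by
    rw [← Nat.cofinite_eq_atTop]; exact hyperfilter_le_cofinite
  have hlim : ∀ k, ∃ c, 0 ≤ c ∧ Tendsto (fun N => p N k) U (𝓝 c) := by
    intro k
    have hK : IsCompact (Set.Icc (0 : ℝ) (f (1 + 1) + 1)) := isCompact_Icc
    obtain ⟨c, hc, hcl⟩ := hK.ultrafilter_le_nhds (U.map fun N => p N k) (by
      rw [le_principal_iff]
      refine Filter.mem_map.2 (Filter.univ_mem' fun N => ?_)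
      refine ⟨hp0 N k, ?_⟩
      have := hb 1 one_pos N (by linarith [(Nat.cast_nonneg N : (0 : ℝ) ≤ N)]) k
      simpa using this)
    exact ⟨c, hc.1, hcl⟩
  choose c hc0 hc using hlim
  refine ⟨c, hc0, fun x hx => ?_⟩
  set M := f (2 * x + 1) + 1 with hM
  have hbound : ∀ N : ℕ, 2 * x ≤ N + 1 → ∀ k, p N k * x ^ k ≤ M * (1 / 2) ^ k := by
    intro N hN k
    have h1 := hb (2 * x) (by linarith) N hN k
    rw [mul_pow] at h1
    rw [one_div, inv_pow, ← div_eq_mul_inv, le_div_iff₀ (by positivity)]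
    linarith
  have hev : ∀ᶠ N : ℕ in atTop, 2 * x ≤ (N : ℝ) + 1 := by
    filter_upwards [eventually_ge_atTop ⌈2 * x⌉₊] with N hN
    have := Nat.ceil_le.1 hN
    linarith
  have hsum : Summable fun k : ℕ => M * (1 / 2 : ℝ) ^ k :=
    (summable_geometric_two).mul_left M
  have ht := tendsto_tsum_of_dominated_convergence (𝓕 := (U : Filter ℕ))
    (f := fun N k => p N k * x ^ k) (g := fun k => c k * x ^ k) hsum
    (fun k => (hc k).mul_const _) (by
      filter_upwards [hU hev] with N hN k
      rw [Real.norm_of_nonneg (mul_nonneg (hp0 N k) (by positivity))]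
      exact hbound N hN k)
  have ht2 : Tendsto (fun N => ∑' k, p N k * x ^ k) U (𝓝 (f x)) := by
    refine Tendsto.mono_left ?_ hU
    have hinv : Tendsto (fun N : ℕ => (1 : ℝ) / (N + 1)) atTop (𝓝 0) :=
      tendsto_one_div_add_atTop_nhds_zero_nat
    have h1 : Tendsto (fun N : ℕ => f (x + 1 / (N + 1))) atTop (𝓝 (f x)) := by
      refine (am_cont f H hx).tendsto.comp ?_
      simpa using hinv.const_add x
    have h2 : Tendsto (fun N : ℕ => ∑' k, p N k * x ^ k - f (x + 1 / (N + 1))) atTop (𝓝 0) := by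
      refine squeeze_zero_norm' ?_ hinv
      filter_upwards [hev] with N hN
      exact (hp N x hx.le (by linarith)).2
    simpa using h2.add h1
  have hsc : Summable fun k => c k * x ^ k := by
    refine Summable.of_nonneg_of_le (fun k => mul_nonneg (hc0 k) (by positivity)) (fun k => ?_) hsum
    refine le_of_tendsto ((hc k).mul_const (x ^ k)) ?_
    filter_upwards [hU hev] with N hN
    exact hbound N hN k
  rw [tendsto_nhds_unique ht2 ht]
  exact hsc.hasSum

theorem hadamard_pow_posSemidef {n : ℕ} (A : Matrix (Fin n) (Fin n) ℝ) (hA : A.PosSemidef)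
    (k : ℕ) : (A.map (fun x => x ^ k)).PosSemidef := by
  induction k with
  | zero =>
    convert Matrix.posSemidef_vecMulVec_self_star (fun _ : Fin n => (1 : ℝ)) using 1
    ext; simp [Matrix.vecMulVec_apply]
  | succ k ih =>
    have h1 : (A.map fun x => x ^ (k + 1)) = (A.map fun x => x ^ k).hadamard A := by
      ext i j; simp [Matrix.hadamard_apply, pow_succ]
    rw [h1]
    exact ih.hadamard hA

/-- Vasudeva's theorem: `f : (0,∞) → ℝ` preserves positive semidefiniteness
entrywise on `P_n((0,∞))` for all `n ≥ 1` iff `f(x) = Σ_{k≥0} c_k x^k` on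
`(0,∞)` with all `c_k ≥ 0`. -/
theorem stmt6 (f : ℝ → ℝ) :
    (∀ n : ℕ, 1 ≤ n → ∀ A : Matrix (Fin n) (Fin n) ℝ, A.PosSemidef →
        (∀ j k, 0 < A j k) → (A.map f).PosSemidef) ↔
    (∃ c : ℕ → ℝ, (∀ k, 0 ≤ c k) ∧
      ∀ x : ℝ, 0 < x → HasSum (fun k => c k * x ^ k) (f x)) := by
  constructor
  · intro hf
    exact am_series f (fwdDiff_nonneg f hf)
  · rintro ⟨c, hc, hs⟩ n - A hA hpos
    refine Matrix.PosSemidef.of_dotProduct_mulVec_nonneg ?_ fun v => ?_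
    · ext i j
      have := hA.1.apply i j
      simp only [star_trivial] at this
      simp [this]
    · have h1 : HasSum (fun k => ∑ i, ∑ j, v i * (c k * A i j ^ k * v j))
          (∑ i, ∑ j, v i * (f (A i j) * v j)) :=
        hasSum_sum fun i _ => hasSum_sum fun j _ =>
          ((hs (A i j) (hpos i j)).mul_right (v j)).mul_left (v i)
      have h2 : dotProduct (star v) (Matrix.mulVec (A.map f) v) = ∑ i, ∑ j, v i * (f (A i j) * v j) := by
        simp [dotProduct, Matrix.mulVec, Finset.mul_sum]
      rw [h2]
      refine h1.nonneg fun k => ?_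
      have h3 := ((hadamard_pow_posSemidef A hA k).smul (hc k)).dotProduct_mulVec_nonneg v
      refine h3.trans_eq ?_
      simp [dotProduct, Matrix.mulVec, Finset.mul_sum]
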